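/- arXiv:2407.16345 — 2 statements merged into one kernel-verified Lean document; each statement's English description precedes it below -/
import Mathlib

section
/- Let n be a positive integer and N = 2n−1. For all k, k′ ∈ {1,...,N} with k ≠ k′, the sets [k]_N^odd and [k′]_N^odd are disjoint; that is, for all j, j′ ∈ {0,...,n−1}, the unordered pairs {[k−j]_N, [k+j]_N} and {[k′−j′]_N, [k′+j′]_N} are distinct. -/
/-- `rep N p` is the unique representative of `p` modulo `N` lying in `{1,...,N}`
(so `rep N N = N` rather than `0`). -/
def rep (N p : ℤ) : ℤ := (p - 1) % N + 1

/-- The unordered pair `{[k-j]_N, [k+j]_N}`. -/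
def oddPair (N k : ℤ) (j : ℕ) : Sym2 ℤ := s(rep N (k - j), rep N (k + j))

/-- The scheduling set `[k]_N^odd = { {[k-j]_N, [k+j]_N} : j = 0,...,n-1 }` for `N = 2n-1`. -/
def oddSet (n : ℕ) (N k : ℤ) : Set (Sym2 ℤ) := {e | ∃ j : ℕ, j < n ∧ e = oddPair N k j}

theorem rep_modEq (N p : ℤ) : rep N p ≡ p [ZMOD N] := by
  simpa [rep] using (Int.mod_modEq (p - 1) N).add_right 1

theorem two_mul_modEq_of_oddPair_eq {N k k' : ℤ} {j j' : ℕ}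
    (h : oddPair N k j = oddPair N k' j') : 2 * k ≡ 2 * k' [ZMOD N] := by
  have hsum : ∀ (l : ℤ) (i : ℕ), rep N (l - i) + rep N (l + i) ≡ 2 * l [ZMOD N] := by
    intro l i
    convert (rep_modEq N (l - i)).add (rep_modEq N (l + i)) using 1
    ring
  have heq : rep N (k - j) + rep N (k + j) = rep N (k' - j') + rep N (k' + j') := by
    rcases Sym2.eq_iff.mp h with ⟨h₁, h₂⟩ | ⟨h₁, h₂⟩ <;> rw [h₁, h₂]
    exact add_comm _ _
  exact (hsum k j).symm.trans (heq ▸ hsum k' j')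

/-- The centre `k` of a pair is determined by the pair when `N` is odd. -/
theorem eq_of_oddPair_eq {N k k' : ℤ} {j j' : ℕ} (hN : Odd N) (hk : k ∈ Set.Icc 1 N)
    (hk' : k' ∈ Set.Icc 1 N) (h : oddPair N k j = oddPair N k' j') : k = k' := by
  have hdvd : N ∣ 2 * (k' - k) := by
    simpa [mul_sub] using (two_mul_modEq_of_oddPair_eq h).dvd
  have hcop : IsCoprime N 2 := by
    obtain ⟨m, rfl⟩ := hN
    exact ⟨1, -m, by ring⟩
  have habs : |k' - k| < N := by
    rw [abs_lt]
    constructor <;> linarith [hk.1, hk.2, hk'.1, hk'.2]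
  linarith [Int.eq_zero_of_abs_lt_dvd (hcop.dvd_of_dvd_mul_left hdvd) habs]

/-- For `n ≥ 1` and `N = 2n-1`, the sets `[k]_N^odd` and `[k']_N^odd` are disjoint for
`k ≠ k'` in `{1,...,N}`; that is, all the corresponding unordered pairs are distinct. -/
theorem stmt1 (n : ℕ) (hn : 1 ≤ n) (N : ℤ) (hN : N = 2 * (n : ℤ) - 1)
    (k k' : ℤ) (hk : k ∈ Set.Icc 1 N) (hk' : k' ∈ Set.Icc 1 N) (hne : k ≠ k') :
    Disjoint (oddSet n N k) (oddSet n N k') ∧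
      ∀ j j' : ℕ, j < n → j' < n → oddPair N k j ≠ oddPair N k' j' := by
  have hodd : Odd N := ⟨(n : ℤ) - 1, by rw [hN]; ring⟩
  refine ⟨Set.disjoint_left.mpr ?_, fun j j' _ _ h => hne (eq_of_oddPair_eq hodd hk hk' h)⟩
  rintro e ⟨j, _, rfl⟩ ⟨j', _, h⟩
  exact hne (eq_of_oddPair_eq hodd hk hk' h)
end

section
/- Let m be an integer with m ≥ 1 and define g̃ : ℝ → ℝ by g̃(x) = 2(x − m)(2^m + 2m² − 2) + 2^m − 2^x. Then g̃ is strictly concave on ℝ (its second derivative is −(ln 2)²·2^x < 0), and g̃ has exactly two real zeros: x = m and a unique x* > m with g̃(x*) = 0; moreover g̃(x) ≠ 0 for every real x ∉ {m, x*}. -/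
/-- A strictly concave function on `ℝ` does not vanish at three distinct points. -/
theorem StrictConcaveOn.not_three_zeros {f : ℝ → ℝ} (hf : StrictConcaveOn ℝ Set.univ f)
    {a b c : ℝ} (hab : a < b) (hbc : b < c) (ha : f a = 0) (hb : f b = 0) (hc : f c = 0) :
    False := by
  have h := hf.slope_anti_adjacent (Set.mem_univ a) (Set.mem_univ c) hab hbc
  simp [ha, hb, hc] at h

/-- The exponential `2 ^ x` eventually exceeds any affine function. -/
theorem exists_ge_affine_lt_two_rpow (x₀ A B : ℝ) (hB : 0 ≤ B) :
    ∃ x : ℝ, x₀ ≤ x ∧ A * x + B < (2 : ℝ) ^ x := by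
  have hL : 0 < Real.log 2 := Real.log_pos one_lt_two
  set L := Real.log 2 with hLdef
  obtain ⟨x, hx⟩ : ∃ x : ℝ, x = max (2 * (A + B) / L ^ 2) (max x₀ 1) := ⟨_, rfl⟩
  have hx₁ : 2 * (A + B) / L ^ 2 ≤ x := hx ▸ le_max_left _ _
  have hx₂ : x₀ ≤ x := hx ▸ (le_max_left _ _).trans (le_max_right _ _)
  have hx₃ : 1 ≤ x := hx ▸ (le_max_right _ _).trans (le_max_right _ _)
  refine ⟨x, hx₂, ?_⟩
  rw [div_le_iff₀ (by positivity)] at hx₁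
  rw [Real.rpow_def_of_pos two_pos, ← hLdef]
  have hLx : 0 ≤ L * x := by positivity
  have hexp := Real.quadratic_le_exp_of_nonneg hLx
  have hmul := mul_le_mul_of_nonneg_right hx₁ (zero_le_one.trans hx₃)
  have hBx : B ≤ B * x := le_mul_of_one_le_right hB hx₃
  linarith [show x * L ^ 2 * x = (L * x) ^ 2 by ring]


/-- For an integer `m ≥ 1` and `g̃(x) = 2(x - m)(2^m + 2m² - 2) + 2^m - 2^x` (with `2^x` the
real exponential), `g̃` is strictly concave on `ℝ` with second derivative
`-(ln 2)²·2^x < 0`, and `g̃` has exactly two real zeros: `x = m` and a unique `x* > m`. -/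
theorem stmt15 (m : ℤ) (hm : 1 ≤ m) (g : ℝ → ℝ)
    (hg : ∀ x : ℝ, g x =
      2 * (x - (m : ℝ)) * ((2 : ℝ) ^ m + 2 * (m : ℝ) ^ 2 - 2) + (2 : ℝ) ^ m - (2 : ℝ) ^ x) :
    StrictConcaveOn ℝ Set.univ g ∧
      (∀ x : ℝ, deriv (deriv g) x = -(Real.log 2) ^ 2 * (2 : ℝ) ^ x) ∧
      (∀ x : ℝ, deriv (deriv g) x < 0) ∧
      g (m : ℝ) = 0 ∧
      ∃ xs : ℝ, (m : ℝ) < xs ∧ g xs = 0 ∧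
        ∀ x : ℝ, g x = 0 ↔ (x = (m : ℝ) ∨ x = xs) := by
  have hlog : 0 < Real.log 2 := Real.log_pos one_lt_two
  have hm' : (1 : ℝ) ≤ m := by exact_mod_cast hm
  have hB : (0 : ℝ) < (2 : ℝ) ^ m := by positivity
  have hrpow : (2 : ℝ) ^ (m : ℝ) = (2 : ℝ) ^ m := Real.rpow_intCast 2 m
  set B : ℝ := (2 : ℝ) ^ m
  obtain ⟨A, hA⟩ : ∃ A : ℝ, A = B + 2 * (m : ℝ) ^ 2 - 2 := ⟨_, rfl⟩
  simp only [← hA] at hg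
  have hAB : B ≤ A := by nlinarith
  have hpow (x : ℝ) : HasDerivAt (fun y : ℝ => (2 : ℝ) ^ y) (Real.log 2 * (2 : ℝ) ^ x) x := by
    simpa [mul_comm] using (hasDerivAt_id x).const_rpow two_pos
  have hg₁ (x : ℝ) : HasDerivAt g (2 * A - Real.log 2 * (2 : ℝ) ^ x) x := by
    rw [funext hg]
    have h := (((((hasDerivAt_id x).sub_const (m : ℝ)).const_mul 2).mul_const A).add_const
      B).sub (hpow x)
    exact h.congr_deriv (by ring)
  have hderiv : deriv g = fun x => 2 * A - Real.log 2 * (2 : ℝ) ^ x :=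
    funext fun x => (hg₁ x).deriv
  have hderiv₂ (x : ℝ) : deriv (deriv g) x = -(Real.log 2) ^ 2 * (2 : ℝ) ^ x := by
    rw [hderiv, (((hpow x).const_mul (Real.log 2)).const_sub (2 * A)).deriv]
    ring
  have hneg (x : ℝ) : deriv (deriv g) x < 0 := by
    rw [hderiv₂, neg_mul]
    exact neg_neg_of_pos (by positivity)
  have hcont : Continuous g := continuous_iff_continuousAt.2 fun x => (hg₁ x).continuousAt
  have hconc : StrictConcaveOn ℝ Set.univ g :=
    strictConcaveOn_of_deriv2_neg' convex_univ hcont.continuousOn fun x _ => hneg x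
  have hgm : g m = 0 := by simp [hg, hrpow]
  have hpos : 0 < g (m + 1) := by
    rw [hg, Real.rpow_add two_pos, hrpow, Real.rpow_one]
    linarith
  obtain ⟨b, hmb, hb⟩ :=
    exists_ge_affine_lt_two_rpow (m + 1) (2 * A) B hB.le
  have hgb : g b < 0 := by
    rw [hg]
    nlinarith
  obtain ⟨xs, hxs, hgxs⟩ :=
    intermediate_value_Icc' hmb hcont.continuousOn ⟨hgb.le, hpos.le⟩
  have hmxs : (m : ℝ) < xs := by linarith [hxs.1]
  refine ⟨hconc, hderiv₂, hneg, hgm, xs, hmxs, hgxs, fun x => ⟨fun hx => ?_, ?_⟩⟩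
  · by_contra! hne
    rcases lt_or_gt_of_ne hne.1 with h | h
    · exact hconc.not_three_zeros h hmxs hx hgm hgxs
    · rcases lt_or_gt_of_ne hne.2 with h' | h'
      · exact hconc.not_three_zeros h h' hgm hx hgxs
      · exact hconc.not_three_zeros hmxs h' hgm hgxs hx
  · rintro (rfl | rfl) <;> assumption
end
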